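/- For every m ≥ 1, the following identity holds in the polynomial ring ℤ[z,t]: Σ_{A_1 A_2 ... A_m} (-1)^{m+n(A)} z^{d(A)} t^{n(A)} = ∏_{i=1}^{m} (1 - (1-t)^{i-1}(1-zt)), where the sum ranges over all Fishburn diagrams with exactly m columns, n(A) = |A_1|+...+|A_m| is the number of dots, and d(A) is the number of indices i with i-1 ∈ A_i. -/

import Mathlib

/-- The Fishburn diagrams with `m` columns: sequences of sets `A_1 … A_m` (indexed
0-based by `Fin m`) with each `A_i` a nonempty subset of `{0, 1, …, i-1}`
(0-based: `A i ⊆ {0, …, i}`). -/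
def fishburnDiagrams (m : ℕ) : Finset (Fin m → Finset ℕ) :=
  Fintype.piFinset fun i => ((Finset.range (i.1 + 1)).powerset.erase ∅)

/-- The number of dots of a Fishburn diagram. -/
def dots {m : ℕ} (A : Fin m → Finset ℕ) : ℕ := ∑ i, (A i).card

/-- The statistic `d(A)`: the number of columns `i` (1-based) with `i - 1 ∈ A_i`,
i.e. 0-based the number of `i` with `i ∈ A i`. -/
def dstat {m : ℕ} (A : Fin m → Finset ℕ) : ℕ :=
  (Finset.univ.filter (fun i : Fin m => i.1 ∈ A i)).card

/-- The variable `z` in `ℤ[z, t]` (as a bivariate polynomial ring). -/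
noncomputable def zVar : MvPolynomial (Fin 2) ℤ := MvPolynomial.X 0

/-- The variable `t` in `ℤ[z, t]`. -/
noncomputable def tVar : MvPolynomial (Fin 2) ℤ := MvPolynomial.X 1

/-- The generating polynomial of the possible entries of a single column. -/
theorem column_sum {R : Type*} [CommRing R] (z t : R) (k : ℕ) :
    ∑ S ∈ (Finset.range (k + 1)).powerset.erase ∅,
        -((-t) ^ S.card * (if k ∈ S then z else 1)) =
      1 - (1 - t) ^ k * (1 - z * t) := by
  have h := Finset.prod_one_add (f := fun i => -t * (if i = k then z else 1))
    (Finset.range (k + 1))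
  simp only [Finset.prod_mul_distrib, Finset.prod_const, Finset.prod_ite_eq'] at h
  rw [Finset.prod_range_succ, Finset.prod_congr rfl (g := fun _ => 1 - t)] at h
  · rw [Finset.prod_const, Finset.card_range,
      ← Finset.add_sum_erase _ _ (Finset.empty_mem_powerset _)] at h
    simp only [if_true, Finset.card_empty, pow_zero, Finset.notMem_empty, if_false] at h
    rw [Finset.sum_neg_distrib]
    linear_combination h
  · intro i hi
    rw [if_neg (Finset.mem_range.mp hi).ne]
    ring

/-- The signed weight of a diagram is the product of the signed weights of its columns. -/
theorem weight_eq_prod {R : Type*} [CommRing R] (z t : R) {m : ℕ} (A : Fin m → Finset ℕ) :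
    (-1) ^ (m + dots A) * z ^ dstat A * t ^ dots A =
      ∏ i, -((-t) ^ (A i).card * (if i.1 ∈ A i then z else 1)) := by
  rw [Finset.prod_neg, Finset.prod_mul_distrib, Finset.prod_pow_eq_pow_sum,
    Finset.prod_ite, Finset.prod_const, Finset.prod_const_one, Finset.card_univ,
    Fintype.card_fin, neg_pow t]
  simp only [dots, dstat]
  ring

/-- For every `m ≥ 1`, in `ℤ[z, t]`:
`Σ_A (-1)^{m + n(A)} z^{d(A)} t^{n(A)} = ∏_{i=1}^{m} (1 - (1-t)^{i-1}(1 - zt))`,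
the sum over all Fishburn diagrams with exactly `m` columns. -/
theorem fishburn_diagram_refined_sum (m : ℕ) (hm : 1 ≤ m) :
    ∑ A ∈ fishburnDiagrams m,
        ((-1 : MvPolynomial (Fin 2) ℤ)) ^ (m + dots A) * zVar ^ (dstat A) * tVar ^ (dots A) =
      ∏ i ∈ Finset.Icc 1 m, (1 - (1 - tVar) ^ (i - 1) * (1 - zVar * tVar)) := by
  simp only [weight_eq_prod, fishburnDiagrams]
  rw [← Finset.prod_univ_sum (fun i : Fin m => (Finset.range (i.1 + 1)).powerset.erase ∅)
    (fun i S => -((-tVar) ^ S.card * (if i.1 ∈ S then zVar else 1)))]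
  simp only [column_sum]
  rw [Fin.prod_univ_eq_prod_range (fun i => 1 - (1 - tVar) ^ i * (1 - zVar * tVar)) m,
    Finset.range_eq_Ico, Finset.prod_Ico_eq_prod_range, ← Finset.Ico_add_one_right_eq_Icc,
    Finset.prod_Ico_eq_prod_range]
  simp
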